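/- Let (W,S) be a finite Coxeter system and c a standard Coxeter element. On the set INT(W,c) = {w ∈ W : w ≤_B c} of interval partitions, the absolute order and the Bruhat order coincide, and (INT(W,c), ≤) is isomorphic to the Boolean lattice of subsets of S. -/

import Mathlib

namespace NCpaper

open CoxeterSystem

variable {B : Type*} {W : Type*} [Group W] {M : CoxeterMatrix B}

/-- The absolute length: minimal length of a factorization into reflections. -/
noncomputable def absLength (cs : CoxeterSystem M W) (w : W) : ℕ :=
  sInf {k | ∃ l : List W, (∀ t ∈ l, cs.IsReflection t) ∧ l.length = k ∧ l.prod = w}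

/-- The absolute order: `v ≤ w` iff `ℓ_T w = ℓ_T (v⁻¹ w) + ℓ_T v`. -/
noncomputable def AbsLe (cs : CoxeterSystem M W) (v w : W) : Prop :=
  absLength cs w = absLength cs (v⁻¹ * w) + absLength cs v

/-- Cover relation of the absolute order. -/
noncomputable def AbsCovBy (cs : CoxeterSystem M W) (v w : W) : Prop :=
  cs.IsReflection (v⁻¹ * w) ∧ absLength cs w = absLength cs v + 1

/-- Generating relation of the Bruhat order: multiply by a reflection, length goes up. -/
def BruhatGen (cs : CoxeterSystem M W) (v w : W) : Prop :=
  cs.IsReflection (v⁻¹ * w) ∧ cs.length v < cs.length w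

/-- The Bruhat order. -/
def BruhatLe (cs : CoxeterSystem M W) : W → W → Prop := Relation.ReflTransGen (BruhatGen cs)

/-- The strict Bruhat order. -/
def BruhatLt (cs : CoxeterSystem M W) : W → W → Prop := Relation.TransGen (BruhatGen cs)

/-- The support of an element: simple reflections occurring in every (equivalently, some)
reduced word for it. -/
def supp (cs : CoxeterSystem M W) (w : W) : Set B :=
  {i | ∀ l : List B, cs.IsReduced l → cs.wordProd l = w → i ∈ l}

/-- A standard Coxeter element: the product of all the simple reflections, each once,
in some order. -/
def IsStdCoxeterElement (cs : CoxeterSystem M W) (c : W) : Prop :=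
  ∃ l : List B, l.Nodup ∧ (∀ i : B, i ∈ l) ∧ cs.wordProd l = c

/-- Generating relation for the order `⊏`: an absolute-order cover which is Bruhat-increasing. -/
noncomputable def SqGen (cs : CoxeterSystem M W) (v w : W) : Prop :=
  AbsCovBy cs v w ∧ BruhatLt cs v w

/-- The order `⊏`. -/
noncomputable def Sq (cs : CoxeterSystem M W) : W → W → Prop :=
  Relation.ReflTransGen (SqGen cs)

/-- Generating relation for the order `≪`: an absolute-order cover which is Bruhat-decreasing. -/
noncomputable def LlGen (cs : CoxeterSystem M W) (v w : W) : Prop :=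
  AbsCovBy cs v w ∧ BruhatLt cs w v

/-- The order `≪`. -/
noncomputable def Ll (cs : CoxeterSystem M W) : W → W → Prop :=
  Relation.ReflTransGen (LlGen cs)


/-! ### Strong exchange -/

section Exchange

open Classical in
/-- The action of a simple reflection on `W × ZMod 2`. -/
noncomputable def sgnFun (cs : CoxeterSystem M W) (i : B) : Function.End (W × ZMod 2) :=
  fun p => (cs.simple i * p.1 * cs.simple i, p.2 + if p.1 = cs.simple i then 1 else 0)

open Classical in
theorem sgnFun_pow (cs : CoxeterSystem M W) (i j : B) (n : ℕ) (t : W) (e : ZMod 2) :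
    ((sgnFun cs i * sgnFun cs j) ^ n : Function.End (W × ZMod 2)) (t, e) =
      ((cs.simple i * cs.simple j) ^ n * t * ((cs.simple i * cs.simple j) ^ n)⁻¹,
        e + ∑ l ∈ Finset.range (2 * n),
          if t = cs.simple j * (cs.simple i * cs.simple j) ^ l then 1 else 0) := by
  have hconj : ∀ n : ℕ, cs.simple j * (cs.simple i * cs.simple j) ^ n =
      ((cs.simple i * cs.simple j) ^ n)⁻¹ * cs.simple j := by
    intro n
    induction n with
    | zero => simp
    | succ n ih =>
      rw [pow_succ, ← mul_assoc, ih, ← pow_succ, pow_succ', mul_inv_rev, mul_inv_rev,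
        cs.inv_simple, cs.inv_simple]
      simp [mul_assoc]
  induction n with
  | zero => simp; rfl
  | succ n ih =>
    rw [pow_succ']
    change (sgnFun cs i) ((sgnFun cs j) (((sgnFun cs i * sgnFun cs j) ^ n : Function.End _) (t, e)))
      = _
    rw [ih]
    have e1 : ((cs.simple i * cs.simple j) ^ n * t * ((cs.simple i * cs.simple j) ^ n)⁻¹ =
        cs.simple j) ↔ t = cs.simple j * (cs.simple i * cs.simple j) ^ (2 * n) := by
      rw [two_mul, pow_add, ← mul_assoc, hconj]
      constructor
      · intro h
        generalize (cs.simple i * cs.simple j) ^ n = g at h ⊢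
        rw [← h]; group
      · rintro rfl; group
    have e2 : (cs.simple j * ((cs.simple i * cs.simple j) ^ n * t *
        ((cs.simple i * cs.simple j) ^ n)⁻¹) * cs.simple j =
        cs.simple i) ↔ t = cs.simple j * (cs.simple i * cs.simple j) ^ (2 * n + 1) := by
      have : (2 * n + 1) = n + 1 + n := by ring
      rw [this, pow_add, pow_succ, ← mul_assoc, ← mul_assoc, hconj]
      have hj : cs.simple j * cs.simple j = 1 := cs.simple_mul_simple_self j
      have hj' : (cs.simple j)⁻¹ = cs.simple j := cs.inv_simple j
      set g := (cs.simple i * cs.simple j) ^ n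
      constructor
      · intro h
        rw [← h]
        simp only [mul_assoc, inv_mul_cancel_left, inv_mul_cancel, mul_one, hj]
        simp only [← mul_assoc, hj]
        simp [mul_assoc]
      · rintro rfl
        simp [mul_assoc]
    simp only [sgnFun, e1, e2]
    rw [show 2 * (n + 1) = 2 * n + 1 + 1 by ring, Finset.sum_range_succ, Finset.sum_range_succ]
    refine Prod.ext ?_ ?_
    · simp only
      rw [pow_succ', mul_inv_rev, mul_inv_rev, cs.inv_simple, cs.inv_simple]
      simp only [mul_assoc]
    · simp only [add_assoc]

theorem sgnFun_liftable (cs : CoxeterSystem M W) : M.IsLiftable (sgnFun cs) := by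
  classical
  intro i j
  funext p
  obtain ⟨t, e⟩ := p
  rw [sgnFun_pow, two_mul, Finset.sum_range_add, cs.simple_mul_simple_pow]
  have : ∀ x, (cs.simple i * cs.simple j) ^ (M i j + x) = (cs.simple i * cs.simple j) ^ x := by
    intro x
    rw [pow_add, cs.simple_mul_simple_pow, one_mul]
  simp only [this, CharTwo.add_self_eq_zero]
  simp; rfl

/-- The action of `W` on `W × ZMod 2`. -/
noncomputable def sgnRep (cs : CoxeterSystem M W) : W →* Function.End (W × ZMod 2) :=
  cs.lift ⟨sgnFun cs, sgnFun_liftable cs⟩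

open Classical in
theorem sgnRep_word (cs : CoxeterSystem M W) (ω : List B) (t : W) (e : ZMod 2) :
    sgnRep cs (cs.wordProd ω) (t, e) =
      (cs.wordProd ω * t * (cs.wordProd ω)⁻¹, e + ((cs.rightInvSeq ω).count t : ZMod 2)) := by
  induction ω with
  | nil => simp; rfl
  | cons i ω ih =>
    rw [cs.wordProd_cons, map_mul]
    change sgnRep cs (cs.simple i) (sgnRep cs (cs.wordProd ω) (t, e)) = _
    rw [ih, sgnRep, cs.lift_apply_simple]
    simp only [sgnFun, rightInvSeq, List.count_cons]
    refine Prod.ext ?_ ?_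
    · simp [mul_assoc]
    · have : (cs.wordProd ω * t * (cs.wordProd ω)⁻¹ = cs.simple i) ↔
        (cs.wordProd ω)⁻¹ * cs.simple i * cs.wordProd ω = t := by
        constructor
        · intro h; rw [← h]; group
        · rintro rfl; group
      simp only [this, beq_iff_eq]
      push_cast
      simp [add_assoc]

/-- The parity cocycle. -/
noncomputable def eta (cs : CoxeterSystem M W) (w t : W) : ZMod 2 := (sgnRep cs w (t, 0)).2

theorem sgnRep_apply (cs : CoxeterSystem M W) (w t : W) (e : ZMod 2) :
    sgnRep cs w (t, e) = (w * t * w⁻¹, e + eta cs w t) := by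
  obtain ⟨ω, rfl⟩ := cs.wordProd_surjective w
  rw [eta, sgnRep_word, sgnRep_word]; simp

theorem eta_mul (cs : CoxeterSystem M W) (u v t : W) :
    eta cs (u * v) t = eta cs v t + eta cs u (v * t * v⁻¹) := by
  have : sgnRep cs (u * v) (t, 0) = sgnRep cs u (sgnRep cs v (t, 0)) := by
    rw [map_mul]; rfl
  rw [sgnRep_apply, sgnRep_apply, sgnRep_apply] at this
  simpa using congrArg Prod.snd this

theorem eta_one (cs : CoxeterSystem M W) (t : W) : eta cs 1 t = 0 := by
  simp [eta]; rfl

theorem eta_refl (cs : CoxeterSystem M W) {t : W} (ht : cs.IsReflection t) : eta cs t t = 1 := by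
  classical
  obtain ⟨w, i, rfl⟩ := ht
  have h1 := eta_mul cs w w⁻¹ (w * cs.simple i * w⁻¹)
  have hs : w⁻¹ * (w * cs.simple i * w⁻¹) * w⁻¹⁻¹ = cs.simple i := by group
  rw [mul_inv_cancel, eta_one, hs] at h1
  have hsi : eta cs (cs.simple i) (cs.simple i) = 1 := by
    rw [eta, sgnRep, cs.lift_apply_simple]; simp [sgnFun]
  rw [eta_mul, hs, eta_mul, hsi]
  simp only [cs.simple_mul_simple_self, cs.inv_simple, one_mul]
  rw [add_comm 1, ← add_assoc, ← h1, zero_add]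

theorem strong_exchange (cs : CoxeterSystem M W) (ω : List B) {t : W} (ht : cs.IsReflection t)
    (hl : cs.length (cs.wordProd ω * t) < cs.length (cs.wordProd ω)) :
    t ∈ cs.rightInvSeq ω := by
  classical
  by_contra hn
  have h0 : eta cs (cs.wordProd ω) t = 0 := by
    rw [eta, sgnRep_word, List.count_eq_zero_of_not_mem hn]; simp
  obtain ⟨ω', hω', hw'⟩ := cs.exists_isReduced (cs.wordProd ω * t)
  have h1 : eta cs (cs.wordProd ω') t = 1 := by
    rw [← hw', eta_mul, eta_refl cs ht]
    simp [h0]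
  have hmem : t ∈ cs.rightInvSeq ω' := by
    by_contra hn'
    rw [eta, sgnRep_word, List.count_eq_zero_of_not_mem hn'] at h1
    simp at h1
  have := (cs.isRightInversion_of_mem_rightInvSeq hω' hmem).2
  rw [← hw', mul_assoc, ht.mul_self, mul_one] at this
  omega

theorem bruhat_down (cs : CoxeterSystem M W) (ω : List B) {v : W}
    (h : BruhatLe cs v (cs.wordProd ω)) : ∃ ω', List.Sublist ω' ω ∧ v = cs.wordProd ω' := by
  induction h using Relation.ReflTransGen.head_induction_on with
  | refl => exact ⟨ω, List.Sublist.refl _, rfl⟩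
  | @head v v1 hg _ ih =>
    obtain ⟨ω1, hs, rfl⟩ := ih
    obtain ⟨hr, hl⟩ := hg
    have hv : v = cs.wordProd ω1 * (v⁻¹ * cs.wordProd ω1) := by
      rw [← hr.inv]; group
    rw [hv] at hl
    have hr' := strong_exchange cs ω1 hr hl
    obtain ⟨j, hj, he⟩ := List.mem_iff_getElem.mp hr'
    refine ⟨ω1.eraseIdx j, (List.eraseIdx_sublist _ _).trans hs, ?_⟩
    rw [← cs.wordProd_mul_getD_rightInvSeq, List.getD_eq_getElem _ _ hj, he]
    exact hv

end Exchange

/-! ### A reflection representation with independent roots and coroots -/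

section Rep

variable [Fintype B] [DecidableEq B]

/-- The coroots. -/
noncomputable def coroot (M : CoxeterMatrix B) (i : B) :
    Module.Dual ℝ ((B → ℝ) × (B → ℝ)) :=
  (∑ j, (-2 * Real.cos (Real.pi / M i j)) • LinearMap.proj j) ∘ₗ LinearMap.fst ℝ _ _ +
    LinearMap.proj i ∘ₗ LinearMap.snd ℝ _ _

/-- The roots. -/
def root (i : B) : (B → ℝ) × (B → ℝ) := (Pi.single i 1, 0)

theorem coroot_root (M : CoxeterMatrix B) (i j : B) :
    coroot M i (root j) = -2 * Real.cos (Real.pi / M i j) := by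
  simp [coroot, root, Pi.single_apply]

theorem coroot_root_self (M : CoxeterMatrix B) (i : B) : coroot M i (root i) = 2 := by
  rw [coroot_root]; simp

theorem coroot_snd (M : CoxeterMatrix B) (i : B) (y : B → ℝ) :
    coroot M i (0, y) = y i := by
  simp [coroot]

/-- Reflections. -/
noncomputable def refl (M : CoxeterMatrix B) (i : B) :
    ((B → ℝ) × (B → ℝ)) ≃ₗ[ℝ] ((B → ℝ) × (B → ℝ)) :=
  Module.reflection (coroot_root_self M i)

theorem refl_apply (M : CoxeterMatrix B) (i : B) (v : (B → ℝ) × (B → ℝ)) :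
    refl M i v = v - coroot M i v • root i := Module.reflection_apply _ _

theorem refl_liftable (M : CoxeterMatrix B) : M.IsLiftable (refl M) := by
  intro i j
  by_cases hij : i = j
  · subst hij
    rw [M.diagonal, pow_one]
    ext1 v
    exact Module.involutive_reflection (coroot_root_self M i) v
  have hne := M.off_diagonal i j hij
  obtain ⟨m, hm⟩ : ∃ m, M i j = m := ⟨_, rfl⟩
  have hm' : M j i = m := by rw [M.symmetric, hm]
  rw [hm] at hne ⊢
  ext1 z
  have key := Module.reflection_mul_reflection_pow_apply (coroot_root_self M i)
    (coroot_root_self M j) m z (2 * Real.cos (2 * Real.pi / m)) (by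
      rw [coroot_root, coroot_root, hm, hm', mul_div_assoc, Real.cos_two_mul]; ring)
  change ((refl M i * refl M j) ^ m) z = _ at key
  rw [key]
  change _ = z
  rcases m with _ | _ | _ | m
  · simp
  · omega
  · have e1 : coroot M i (root j) = 0 := by rw [coroot_root, hm]; simp
    have e2 : coroot M j (root i) = 0 := by rw [coroot_root, hm']; simp
    rw [e1, e2]
    norm_num
    module
  · have hpos : (0 : ℝ) < ((m + 1 + 1 + 1 : ℕ) : ℝ) := by positivity
    have hm3 : (3 : ℝ) ≤ ((m + 1 + 1 + 1 : ℕ) : ℝ) := by push_cast; linarith [m.cast_nonneg (α := ℝ)]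
    set n := m + 1 + 1 + 1 with hn
    set θ := 2 * Real.pi / n with hθ
    have hsin : Real.sin θ ≠ 0 := by
      apply ne_of_gt
      apply Real.sin_pos_of_pos_of_lt_pi
      · positivity
      · rw [hθ, div_lt_iff₀ hpos]; nlinarith [Real.pi_pos]
    have hnθ : (n : ℝ) * θ = 2 * Real.pi := by rw [hθ]; field_simp
    have hS : ∀ k : ℤ, (Polynomial.Chebyshev.S ℝ k).eval (2 * Real.cos θ) =
        Real.sin ((k + 1) * θ) / Real.sin θ := by
      intro k
      rw [eq_div_iff hsin, Polynomial.Chebyshev.S_two_mul_real_cos]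
    rcases Nat.even_or_odd' n with ⟨p, hp | hp⟩
    · have h0 : (Polynomial.Chebyshev.S ℝ ((p : ℤ) - 1)).eval (2 * Real.cos θ) = 0 := by
        rw [hS]
        have : (((p : ℤ) - 1 : ℤ) + 1 : ℝ) * θ = Real.pi := by
          rw [hp] at hnθ; push_cast at hnθ ⊢; linarith
        rw [this]; simp
      have a1 : ((n : ℤ) - 2) / 2 = (p : ℤ) - 1 := by omega
      have a2 : ((n : ℤ) - 1) / 2 = (p : ℤ) - 1 := by omega
      rw [a1, a2, h0]; simp
    · have h0 : (Polynomial.Chebyshev.S ℝ (p : ℤ)).eval (2 * Real.cos θ) +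
          (Polynomial.Chebyshev.S ℝ ((p : ℤ) - 1)).eval (2 * Real.cos θ) = 0 := by
        rw [hS, hS]
        have : (((p : ℤ) : ℝ) + 1) * θ = 2 * Real.pi - (((p : ℤ) - 1 : ℤ) + 1 : ℝ) * θ := by
          rw [hp] at hnθ; push_cast at hnθ ⊢; linarith
        rw [this, Real.sin_two_pi_sub]; ring
      have a1 : ((n : ℤ) - 2) / 2 = (p : ℤ) - 1 := by omega
      have a2 : ((n : ℤ) - 1) / 2 = (p : ℤ) := by omega
      have a3 : ((n : ℤ) - 3) / 2 = (p : ℤ) - 1 := by omega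
      have a4 : (n : ℤ) / 2 = (p : ℤ) := by omega
      rw [a1, a2, a3, a4, h0]; simp

/-- The representation. -/
noncomputable def rho (cs : CoxeterSystem M W) :
    W →* (((B → ℝ) × (B → ℝ)) ≃ₗ[ℝ] ((B → ℝ) × (B → ℝ))) :=
  cs.lift ⟨refl M, refl_liftable M⟩

theorem rho_simple (cs : CoxeterSystem M W) (i : B) (v : (B → ℝ) × (B → ℝ)) :
    rho cs (cs.simple i) v = v - coroot M i v • root i := by
  rw [rho, cs.lift_apply_simple, refl_apply]

theorem rho_mul (cs : CoxeterSystem M W) (u w : W) (v : (B → ℝ) × (B → ℝ)) :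
    rho cs (u * w) v = rho cs u (rho cs w v) := by
  rw [map_mul]; rfl

theorem rho_word_fix (cs : CoxeterSystem M W) (ω : List B) (v : (B → ℝ) × (B → ℝ))
    (h : ∀ i ∈ ω, coroot M i v = 0) : rho cs (cs.wordProd ω) v = v := by
  induction ω with
  | nil => simp
  | cons i ω ih =>
    rw [cs.wordProd_cons, rho_mul, ih (fun j hj => h j (by simp [hj])), rho_simple, h i (by simp)]
    simp

theorem rho_word_coord (cs : CoxeterSystem M W) (ω : List B) (v : (B → ℝ) × (B → ℝ)) (i : B)
    (h : i ∉ ω) : (rho cs (cs.wordProd ω) v).1 i = v.1 i := by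
  induction ω with
  | nil => simp
  | cons j ω ih =>
    rw [List.mem_cons, not_or] at h
    rw [cs.wordProd_cons, rho_mul, rho_simple]
    simp [root, ih h.2, Pi.single_apply, h.1]

theorem fix_word (cs : CoxeterSystem M W) (ω : List B) (hω : ω.Nodup) (v : (B → ℝ) × (B → ℝ))
    (h : rho cs (cs.wordProd ω) v = v) : ∀ i ∈ ω, coroot M i v = 0 := by
  induction ω with
  | nil => simp
  | cons i ω ih =>
    rw [List.nodup_cons] at hω
    rw [cs.wordProd_cons, rho_mul] at h
    have h2 : rho cs (cs.wordProd ω) v = v - coroot M i v • root i := by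
      have h5 := congrArg (rho cs (cs.simple i)) h
      rw [← rho_mul, cs.simple_mul_simple_self, map_one] at h5
      rw [← rho_simple cs, ← h5]
      rfl
    have h3 := rho_word_coord cs ω v i hω.1
    rw [h2] at h3
    have h4 : coroot M i v = 0 := by simpa [root] using h3
    rw [h4, zero_smul, sub_zero] at h2
    intro j hj
    rcases List.mem_cons.mp hj with rfl | hj
    · exact h4
    · exact ih hω.2 h2 j hj

/-- Fixed space. -/
noncomputable def fixSp (cs : CoxeterSystem M W) (w : W) : Submodule ℝ ((B → ℝ) × (B → ℝ)) :=
  LinearMap.eqLocus (rho cs w).toLinearMap LinearMap.id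

theorem mem_fixSp (cs : CoxeterSystem M W) (w : W) (v : (B → ℝ) × (B → ℝ)) :
    v ∈ fixSp cs w ↔ rho cs w v = v := Iff.rfl

theorem fixSp_mul (cs : CoxeterSystem M W) (u w : W) :
    fixSp cs u ⊓ fixSp cs w ≤ fixSp cs (u * w) := by
  rintro v ⟨h1, h2⟩
  rw [SetLike.mem_coe, mem_fixSp] at h1 h2
  rw [mem_fixSp, rho_mul, h2, h1]

theorem finrank_inf_ge (P Q : Submodule ℝ ((B → ℝ) × (B → ℝ))) :
    Module.finrank ℝ P + Module.finrank ℝ Q ≤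
      Module.finrank ℝ ((B → ℝ) × (B → ℝ)) + Module.finrank ℝ (P ⊓ Q : Submodule ℝ _) := by
  rw [← Submodule.finrank_sup_add_finrank_inf_eq]
  have := Submodule.finrank_le (P ⊔ Q)
  omega

theorem fixSp_refl (cs : CoxeterSystem M W) {t : W} (ht : cs.IsReflection t) :
    Module.finrank ℝ ((B → ℝ) × (B → ℝ)) ≤ Module.finrank ℝ (fixSp cs t) + 1 := by
  obtain ⟨w, i, rfl⟩ := ht
  set f : ((B → ℝ) × (B → ℝ)) →ₗ[ℝ] ℝ := coroot M i ∘ₗ (rho cs w⁻¹).toLinearMap with hf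
  have h1 : LinearMap.ker f ≤ fixSp cs (w * cs.simple i * w⁻¹) := by
    intro v hv
    have hv' : coroot M i (rho cs w⁻¹ v) = 0 := hv
    rw [mem_fixSp, rho_mul, rho_mul, rho_simple, hv', zero_smul, sub_zero, ← rho_mul]
    simp
  have h2 := Submodule.finrank_mono h1
  have h3 := LinearMap.finrank_range_add_finrank_ker f
  have h4 := Submodule.finrank_le (LinearMap.range f)
  rw [Module.finrank_self] at h4
  omega

theorem fixSp_list (cs : CoxeterSystem M W) (l : List W) (hl : ∀ t ∈ l, cs.IsReflection t) :
    Module.finrank ℝ ((B → ℝ) × (B → ℝ)) ≤ Module.finrank ℝ (fixSp cs l.prod) + l.length := by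
  induction l with
  | nil =>
    have : fixSp cs (List.prod []) = ⊤ := by
      rw [eq_top_iff]; intro v _; rw [mem_fixSp]; simp
    rw [this]; simp
  | cons t l ih =>
    have h1 := ih (fun t ht => hl t (by simp [ht]))
    have h2 := fixSp_refl cs (hl t (by simp))
    have h3 := finrank_inf_ge (fixSp cs t) (fixSp cs l.prod)
    have h4 := Submodule.finrank_mono (fixSp_mul cs t l.prod)
    rw [List.prod_cons, List.length_cons]
    omega

theorem fixSp_word (cs : CoxeterSystem M W) (ω : List B) (hω : ω.Nodup) :
    Module.finrank ℝ (fixSp cs (cs.wordProd ω)) + ω.length ≤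
      Module.finrank ℝ ((B → ℝ) × (B → ℝ)) := by
  set Φ : ((B → ℝ) × (B → ℝ)) →ₗ[ℝ] (ω.toFinset → ℝ) :=
    LinearMap.pi (fun i => coroot M i.1) with hΦ
  have hsurj : Function.Surjective Φ := by
    intro y
    refine ⟨(0, fun i => if h : i ∈ ω.toFinset then y ⟨i, h⟩ else 0), ?_⟩
    funext i
    change coroot M i.1 _ = _
    rw [coroot_snd, dif_pos i.2]
  have h1 : fixSp cs (cs.wordProd ω) ≤ LinearMap.ker Φ := by
    intro v hv
    rw [LinearMap.mem_ker]
    funext i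
    exact fix_word cs ω hω v hv i.1 (List.mem_toFinset.mp i.2)
  have h2 := Submodule.finrank_mono h1
  have h3 := LinearMap.finrank_range_add_finrank_ker Φ
  rw [LinearMap.range_eq_top.mpr hsurj, finrank_top, Module.finrank_fintype_fun_eq_card,
    Fintype.card_coe, List.toFinset_card_of_nodup hω] at h3
  omega

theorem absLength_spec (cs : CoxeterSystem M W) (w : W) :
    ∃ l : List W, (∀ t ∈ l, cs.IsReflection t) ∧ l.length = absLength cs w ∧ l.prod = w := by
  have hne : {k | ∃ l : List W, (∀ t ∈ l, cs.IsReflection t) ∧ l.length = k ∧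
      l.prod = w}.Nonempty := by
    obtain ⟨ω, rfl⟩ := cs.wordProd_surjective w
    refine ⟨_, ω.map cs.simple, ?_, rfl, rfl⟩
    intro t ht
    obtain ⟨i, _, rfl⟩ := List.mem_map.mp ht
    exact cs.isReflection_simple i
  exact Nat.sInf_mem hne

theorem absLength_le (cs : CoxeterSystem M W) (l : List W) (hl : ∀ t ∈ l, cs.IsReflection t) :
    absLength cs l.prod ≤ l.length := Nat.sInf_le ⟨l, hl, rfl, rfl⟩

theorem absLength_word_le (cs : CoxeterSystem M W) (ω : List B) :
    absLength cs (cs.wordProd ω) ≤ ω.length := by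
  have := absLength_le cs (ω.map cs.simple) (by
    intro t ht
    obtain ⟨i, _, rfl⟩ := List.mem_map.mp ht
    exact cs.isReflection_simple i)
  rwa [List.length_map] at this

theorem fixSp_abs (cs : CoxeterSystem M W) (w : W) :
    Module.finrank ℝ ((B → ℝ) × (B → ℝ)) ≤ Module.finrank ℝ (fixSp cs w) + absLength cs w := by
  obtain ⟨l, h1, h2, h3⟩ := absLength_spec cs w
  have := fixSp_list cs l h1
  rwa [h2, h3] at this

theorem absLength_word (cs : CoxeterSystem M W) (ω : List B) (hω : ω.Nodup) :
    absLength cs (cs.wordProd ω) = ω.length := by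
  have h1 := fixSp_abs cs (cs.wordProd ω)
  have h2 := fixSp_word cs ω hω
  have h3 := absLength_word_le cs ω
  omega

theorem length_word (cs : CoxeterSystem M W) (ω : List B) (hω : ω.Nodup) :
    cs.length (cs.wordProd ω) = ω.length := by
  apply le_antisymm (cs.length_wordProd_le ω)
  obtain ⟨ω', h1, h2⟩ := cs.exists_isReduced (cs.wordProd ω)
  rw [← absLength_word cs ω hω, h2, h1]
  exact absLength_word_le cs ω'

theorem absLe_subset (cs : CoxeterSystem M W) (ω ω' : List B) (hω : ω.Nodup) (hω' : ω'.Nodup)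
    (h : AbsLe cs (cs.wordProd ω') (cs.wordProd ω)) : ω' ⊆ ω := by
  unfold AbsLe at h
  rw [absLength_word cs ω hω, absLength_word cs ω' hω'] at h
  have h1 := fixSp_mul cs (cs.wordProd ω') ((cs.wordProd ω')⁻¹ * cs.wordProd ω)
  rw [mul_inv_cancel_left] at h1
  have h2 := fixSp_abs cs ((cs.wordProd ω')⁻¹ * cs.wordProd ω)
  have h3 := fixSp_abs cs (cs.wordProd ω')
  rw [absLength_word cs ω' hω'] at h3
  have h4 := fixSp_word cs ω hω
  have h5 := finrank_inf_ge (fixSp cs (cs.wordProd ω'))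
    (fixSp cs ((cs.wordProd ω')⁻¹ * cs.wordProd ω))
  have h6 := Submodule.eq_of_le_of_finrank_le h1 (by omega)
  intro i hi
  by_contra hn
  have h7 : ((0, Pi.single i 1) : (B → ℝ) × (B → ℝ)) ∈ fixSp cs (cs.wordProd ω) := by
    rw [mem_fixSp]
    apply rho_word_fix
    intro j hj
    rw [coroot_snd, Pi.single_apply, if_neg]
    rintro rfl
    exact hn hj
  rw [← h6] at h7
  have h8 := fix_word cs ω' hω' _ h7.1 i hi
  rw [coroot_snd] at h8
  simp at h8

theorem sublist_refl (cs : CoxeterSystem M W) {ω' ω : List B} (h : List.Sublist ω' ω) :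
    ∃ tl : List W, (∀ t ∈ tl, cs.IsReflection t) ∧ tl.length + ω'.length = ω.length ∧
      cs.wordProd ω' * tl.prod = cs.wordProd ω := by
  induction h with
  | slnil => exact ⟨[], by simp, by simp, by simp⟩
  | @cons ω' ω a h ih =>
    obtain ⟨tl, h1, h2, h3⟩ := ih
    refine ⟨tl ++ [(cs.wordProd ω)⁻¹ * cs.simple a * cs.wordProd ω], ?_, ?_, ?_⟩
    · intro t ht
      rcases List.mem_append.mp ht with ht | ht
      · exact h1 t ht
      · rw [List.mem_singleton] at ht
        exact ⟨(cs.wordProd ω)⁻¹, a, by rw [ht, inv_inv]⟩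
    · simp; omega
    · rw [List.prod_append, List.prod_singleton, ← mul_assoc, h3, cs.wordProd_cons]; group
  | @cons_cons ω' ω a h ih =>
    obtain ⟨tl, h1, h2, h3⟩ := ih
    refine ⟨tl, h1, by simp; omega, ?_⟩
    rw [cs.wordProd_cons, cs.wordProd_cons, mul_assoc, h3]

theorem absLe_of_sublist (cs : CoxeterSystem M W) {ω' ω : List B} (h : List.Sublist ω' ω)
    (hω : ω.Nodup) : AbsLe cs (cs.wordProd ω') (cs.wordProd ω) := by
  obtain ⟨tl, h1, h2, h3⟩ := sublist_refl cs h
  have h4 : (cs.wordProd ω')⁻¹ * cs.wordProd ω = tl.prod := by rw [← h3]; group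
  have h5 := absLength_le cs tl h1
  obtain ⟨l, g1, g2, g3⟩ := absLength_spec cs tl.prod
  have h6 := absLength_le cs (ω'.map cs.simple ++ l) (by
    intro t ht
    rcases List.mem_append.mp ht with ht | ht
    · obtain ⟨i, _, rfl⟩ := List.mem_map.mp ht
      exact cs.isReflection_simple i
    · exact g1 t ht)
  have h7 : (ω'.map cs.simple ++ l).prod = cs.wordProd ω := by
    rw [List.prod_append, g3, ← h3]; rfl
  rw [h7, List.length_append, List.length_map, absLength_word cs ω hω] at h6
  unfold AbsLe
  rw [h4, absLength_word cs ω hω, absLength_word cs ω' (hω.sublist h)]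
  omega

theorem bruhatLe_of_sublist (cs : CoxeterSystem M W) {ω' ω : List B} (h : List.Sublist ω' ω) :
    ∀ p : List B, (p ++ ω).Nodup → BruhatLe cs (cs.wordProd (p ++ ω')) (cs.wordProd (p ++ ω)) := by
  induction h with
  | slnil => intro p _; exact Relation.ReflTransGen.refl
  | @cons ω' ω a h ih =>
    intro p hp
    have hs : List.Sublist (p ++ ω) (p ++ a :: ω) :=
      (List.Sublist.refl p).append (List.sublist_cons_self a ω)
    refine (ih p (hp.sublist hs)).tail ⟨?_, ?_⟩
    · refine ⟨(cs.wordProd ω)⁻¹, a, ?_⟩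
      rw [cs.wordProd_append, cs.wordProd_append, cs.wordProd_cons]; group
    · rw [length_word cs _ hp, length_word cs _ (hp.sublist hs)]; simp
  | @cons_cons ω' ω a h ih =>
    intro p hp
    have := ih (p ++ [a]) (by simpa using hp)
    simpa using this

theorem filter_of_sublist {ω l : List B} (h : List.Sublist ω l) (hl : l.Nodup) :
    l.filter (fun i => decide (i ∈ ω.toFinset)) = ω := by
  have h1 : (l.filter (fun i => decide (i ∈ ω.toFinset))).Nodup := hl.filter _
  have h2 : List.Sublist ω (l.filter (fun i => decide (i ∈ ω.toFinset))) := by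
    have := h.filter (fun i => decide (i ∈ ω.toFinset))
    rwa [List.filter_eq_self.mpr (by simp)] at this
  refine (h2.eq_of_length_le ?_).symm
  apply (List.Nodup.subperm h1 ?_).length_le
  intro i hi
  simpa using (List.mem_filter.mp hi).2

end Rep

/-- On the set of interval partitions `INT(W,c) = {w : w ≤_B c}`, the absolute and
Bruhat orders coincide, and this poset is isomorphic to the Boolean lattice of
subsets of `S`. -/
theorem stmt16 [Finite W] [Fintype B] [DecidableEq B] (cs : CoxeterSystem M W) (c : W)
    (hc : IsStdCoxeterElement cs c) :
    (∀ v w : W, BruhatLe cs v c → BruhatLe cs w c →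
      (AbsLe cs v w ↔ BruhatLe cs v w)) ∧
    ∃ φ : {w : W // BruhatLe cs w c} ≃ Finset B,
      ∀ v w : {w : W // BruhatLe cs w c}, AbsLe cs v.1 w.1 ↔ φ v ⊆ φ w := by
  obtain ⟨l, hl, hall, rfl⟩ := hc
  set P : Finset B → List B := fun J => l.filter (fun i => decide (i ∈ J)) with hP
  have hPn : ∀ J, (P J).Nodup := fun J => hl.filter _
  have hmem : ∀ J i, i ∈ P J ↔ i ∈ J := by
    intro J i; simp [hP, hall]
  have hsub : ∀ J K, J ⊆ K → List.Sublist (P J) (P K) := by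
    intro J K h
    exact List.monotone_filter_right l (fun i hi => by simpa using h (by simpa using hi))
  have habs : ∀ J K, AbsLe cs (cs.wordProd (P J)) (cs.wordProd (P K)) ↔ J ⊆ K := by
    intro J K
    constructor
    · intro h i hi
      exact (hmem K i).mp (absLe_subset cs _ _ (hPn K) (hPn J) h ((hmem J i).mpr hi))
    · intro h
      exact absLe_of_sublist cs (hsub J K h) (hPn K)
  have hinj : ∀ J K, cs.wordProd (P J) = cs.wordProd (P K) → J = K := by
    intro J K h
    apply Finset.Subset.antisymm
    · rw [← habs, ← h, habs]
    · rw [← habs, h, habs]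
  have hbr : ∀ J K, BruhatLe cs (cs.wordProd (P J)) (cs.wordProd (P K)) ↔ J ⊆ K := by
    intro J K
    constructor
    · intro h
      obtain ⟨ω', h1, h2⟩ := bruhat_down cs _ h
      have h3 : P ω'.toFinset = ω' := filter_of_sublist (h1.trans List.filter_sublist) hl
      rw [← h3] at h2
      rw [hinj _ _ h2]
      intro i hi
      exact (hmem K i).mp (h1.subset (List.mem_toFinset.mp hi))
    · intro h
      exact bruhatLe_of_sublist cs (hsub J K h) [] (by simpa using hPn K)
  have hex : ∀ v, BruhatLe cs v (cs.wordProd l) → ∃ J, cs.wordProd (P J) = v := by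
    intro v h
    obtain ⟨ω', h1, rfl⟩ := bruhat_down cs _ h
    exact ⟨ω'.toFinset, congrArg cs.wordProd (filter_of_sublist h1 hl)⟩
  have hle : ∀ J, BruhatLe cs (cs.wordProd (P J)) (cs.wordProd l) := by
    intro J
    exact bruhatLe_of_sublist cs (ω' := P J) (ω := l) List.filter_sublist [] (by simpa using hl)
  constructor
  · intro v w hv hw
    obtain ⟨J, rfl⟩ := hex v hv
    obtain ⟨K, rfl⟩ := hex w hw
    rw [habs, hbr]
  · let ψ : Finset B → {w : W // BruhatLe cs w (cs.wordProd l)} :=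
      fun J => ⟨cs.wordProd (P J), hle J⟩
    have hψ : Function.Bijective ψ := by
      constructor
      · intro J K h
        exact hinj J K (congrArg Subtype.val h)
      · rintro ⟨v, hv⟩
        obtain ⟨J, rfl⟩ := hex v hv
        exact ⟨J, rfl⟩
    refine ⟨(Equiv.ofBijective ψ hψ).symm, ?_⟩
    intro v w
    obtain ⟨J, rfl⟩ := hψ.2 v
    obtain ⟨K, rfl⟩ := hψ.2 w
    rw [Equiv.ofBijective_symm_apply_apply, Equiv.ofBijective_symm_apply_apply]
    exact habs J K

end NCpaper
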